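/- Let p be a prime, u ≥ 0 an integer, and H a finite abelian p-group. Then, summing over all isomorphism classes of finite abelian p-groups G (equivalently, over all partitions λ with G_λ = ⊕_i ℤ/p^{λ_i}ℤ), one has ∑_G (#Sur(G, H) / (|G|^u · |Aut(G)|)) · ∏_{k=1}^∞ (1 − p^{−k−u}) = |H|^{−u}. In other words, the random finite abelian p-group Γ with P[Γ ≅ G] = (1/(|G|^u·|Aut(G)|))·∏_{k=1}^∞(1 − p^{−k−u}) satisfies E[#Sur(Γ, H)] = |H|^{−u}. -/

import Mathlib

/-- The number of surjective group homomorphisms from `A` to `G`. -/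
noncomputable def numSur (A G : Type*) [AddCommGroup A] [AddCommGroup G] : ℕ :=
  Nat.card {f : A →+ G // Function.Surjective f}



/-- The subgroup of `A × ℤ` whose intersection with `A` is `N`, whose projection to `ℤ` is `dℤ`,
and whose elements above `d` are the lifts of `t`. -/
def twistedSubgroup {A : Type*} [AddCommGroup A] (N : AddSubgroup A) (d : ℕ) (t : A ⧸ N) :
    AddSubgroup (A × ℤ) where
  carrier := {x | ∃ c : ℤ, x.2 = c * d ∧ (x.1 : A ⧸ N) = c • t}
  zero_mem' := ⟨0, by simp, by simp⟩
  add_mem' := by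
    rintro x y ⟨c, hc, hc'⟩ ⟨e, he, he'⟩
    exact ⟨c + e, by simp [hc, he, add_mul], by simp [hc', he', add_smul]⟩
  neg_mem' := by
    rintro x ⟨c, hc, hc'⟩
    exact ⟨-c, by simp [hc], by simp [hc']⟩

section twisted

variable {A : Type*} [AddCommGroup A] (N : AddSubgroup A) {d : ℕ} (t : A ⧸ N)

theorem mem_twistedSubgroup {x : A × ℤ} :
    x ∈ twistedSubgroup N d t ↔ ∃ c : ℤ, x.2 = c * d ∧ (x.1 : A ⧸ N) = c • t :=
  Iff.rfl

theorem comap_inl_twistedSubgroup (hd : d ≠ 0) :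
    (twistedSubgroup N d t).comap (AddMonoidHom.inl A ℤ) = N := by
  ext a
  simp only [AddSubgroup.mem_comap, mem_twistedSubgroup, AddMonoidHom.inl_apply]
  constructor
  · rintro ⟨c, hc, h⟩
    have : c = 0 := by simpa [hd] using hc.symm
    subst this
    simpa using h
  · intro h
    exact ⟨0, by simp, by simpa using h⟩

theorem map_snd_twistedSubgroup :
    (twistedSubgroup N d t).map (AddMonoidHom.snd A ℤ) = AddSubgroup.zmultiples (d : ℤ) := by
  ext z
  simp only [AddSubgroup.mem_map, mem_twistedSubgroup, AddSubgroup.mem_zmultiples_iff]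
  constructor
  · rintro ⟨x, ⟨c, hc, -⟩, rfl⟩
    exact ⟨c, by simp [hc]⟩
  · rintro ⟨c, rfl⟩
    obtain ⟨a, ha⟩ := QuotientAddGroup.mk_surjective (c • t)
    exact ⟨(a, c * d), ⟨c, rfl, ha⟩, by simp⟩

theorem mk_natCast_mem_twistedSubgroup (hd : d ≠ 0) {a : A} :
    (a, (d : ℤ)) ∈ twistedSubgroup N d t ↔ (a : A ⧸ N) = t := by
  rw [mem_twistedSubgroup]
  constructor
  · rintro ⟨c, hc, h⟩
    have : c = 1 := by
      have : (d : ℤ) ≠ 0 := by exact_mod_cast hd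
      simp only at hc
      exact mul_right_cancel₀ this (by rw [← hc, one_mul])
    simpa [this] using h
  · intro h
    exact ⟨1, by simp, by simpa using h⟩

theorem AddSubgroup.index_eq_index_comap_inl_mul_index_map_snd (M : AddSubgroup (A × ℤ)) :
    M.index = (M.comap (AddMonoidHom.inl A ℤ)).index * (M.map (AddMonoidHom.snd A ℤ)).index := by
  have hr : (AddMonoidHom.snd A ℤ).range = ⊤ :=
    AddMonoidHom.range_eq_top.2 Prod.snd_surjective
  have hk : (AddMonoidHom.snd A ℤ).ker = (AddMonoidHom.inl A ℤ).range := by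
    ext ⟨a, z⟩
    rw [AddMonoidHom.mem_ker]
    simp [eq_comm, AddMonoidHom.mem_range]
  rw [AddSubgroup.index_map, hr, AddSubgroup.index_top, mul_one, AddSubgroup.index_comap, hk,
    ← AddSubgroup.relIndex_sup_right, sup_comm M, AddSubgroup.relIndex_mul_index le_sup_right]

theorem index_twistedSubgroup (hd : d ≠ 0) : (twistedSubgroup N d t).index = N.index * d := by
  rw [AddSubgroup.index_eq_index_comap_inl_mul_index_map_snd, comap_inl_twistedSubgroup _ _ hd,
    map_snd_twistedSubgroup, Int.index_zmultiples, Int.natAbs_natCast]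

theorem exists_eq_twistedSubgroup (M : AddSubgroup (A × ℤ)) :
    ∃ t, M = twistedSubgroup (M.comap (AddMonoidHom.inl A ℤ))
      (M.map (AddMonoidHom.snd A ℤ)).index t := by
  set d := (M.map (AddMonoidHom.snd A ℤ)).index with hd
  have hM : M.map (AddMonoidHom.snd A ℤ) = AddSubgroup.zmultiples (d : ℤ) := by
    obtain ⟨z, hz⟩ := Int.subgroup_cyclic (M.map (AddMonoidHom.snd A ℤ))
    rw [← AddSubgroup.zmultiples_eq_closure] at hz
    rw [hd, hz, Int.index_zmultiples]
    exact (Int.zmultiples_natAbs z).symm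
  obtain ⟨⟨a, z⟩, ha, hz⟩ : (d : ℤ) ∈ M.map (AddMonoidHom.snd A ℤ) := by
    rw [hM]; exact AddSubgroup.mem_zmultiples _
  obtain rfl : z = d := hz
  refine ⟨(a : A ⧸ _), ?_⟩
  ext ⟨b, z⟩
  have key (c : ℤ) (hc : z = c * d) :
      (b, z) ∈ M ↔ (b : A ⧸ M.comap (AddMonoidHom.inl A ℤ)) = c • (a : A ⧸ _) := by
    rw [← QuotientAddGroup.mk_zsmul, eq_comm, QuotientAddGroup.eq, AddSubgroup.mem_comap,
      ← AddSubgroup.add_mem_cancel_left M (M.neg_mem (M.zsmul_mem ha c))]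
    simp [hc]
  rw [mem_twistedSubgroup]
  constructor
  · intro h
    have : z ∈ M.map (AddMonoidHom.snd A ℤ) := ⟨_, h, rfl⟩
    rw [hM, AddSubgroup.mem_zmultiples_iff] at this
    obtain ⟨c, hc⟩ := this
    have hc : z = c * d := by rw [← hc]; simp
    exact ⟨c, hc, (key c hc).1 h⟩
  · rintro ⟨c, hc, h⟩
    exact (key c hc).2 h

end twisted

/-- Subgroups of index `p ^ n` in `A × ℤ`, in terms of the subgroups of `A`. -/
noncomputable def subgroupsProdIntEquiv (A : Type*) [AddCommGroup A] {p : ℕ} (hp : p.Prime)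
    (n : ℕ) :
    (Σ ij : Finset.HasAntidiagonal.antidiagonal n,
      Σ N : {N : AddSubgroup A // N.index = p ^ ij.1.1}, A ⧸ N.1) ≃
      {M : AddSubgroup (A × ℤ) // M.index = p ^ n} := by
  refine Equiv.ofBijective (fun x => ⟨twistedSubgroup x.2.1.1 (p ^ x.1.1.2) x.2.2, ?_⟩) ⟨?_, ?_⟩
  · rw [index_twistedSubgroup _ _ (pow_ne_zero _ hp.ne_zero), x.2.1.2, ← pow_add,
      Finset.HasAntidiagonal.mem_antidiagonal.1 x.1.2]
  · rintro ⟨⟨⟨i, j⟩, hij⟩, ⟨N, hN⟩, t⟩ ⟨⟨⟨i', j'⟩, hij'⟩, ⟨N', hN'⟩, t'⟩ h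
    simp only [Subtype.mk.injEq] at h hN hN'
    have hd (j : ℕ) : p ^ j ≠ 0 := pow_ne_zero _ hp.ne_zero
    obtain rfl : N = N' := by
      rw [← comap_inl_twistedSubgroup N t (hd j), h, comap_inl_twistedSubgroup _ _ (hd j')]
    obtain rfl : i = i' := Nat.pow_right_injective hp.two_le (hN.symm.trans hN')
    obtain rfl : j = j' := by
      simp only [Finset.HasAntidiagonal.mem_antidiagonal] at hij hij'
      omega
    obtain ⟨a, rfl⟩ := QuotientAddGroup.mk_surjective t
    obtain rfl : (a : A ⧸ N) = t' := by
      rw [← mk_natCast_mem_twistedSubgroup N t' (hd j), ← h]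
      exact (mk_natCast_mem_twistedSubgroup N _ (hd j)).2 rfl
    rfl
  · rintro ⟨M, hM⟩
    have h := M.index_eq_index_comap_inl_mul_index_map_snd
    rw [hM] at h
    obtain ⟨i, j, hij, hi, hj⟩ := (Nat.dvd_prime_pow hp).1 (Dvd.intro _ h.symm) |>.elim
      fun i hi => (Nat.dvd_prime_pow hp).1 (Dvd.intro_left _ h.symm) |>.elim
      fun j hj => show ∃ i j, i + j = n ∧ (M.comap (AddMonoidHom.inl A ℤ)).index = p ^ i ∧
        (M.map (AddMonoidHom.snd A ℤ)).index = p ^ j from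
        ⟨i, j, Nat.pow_right_injective hp.two_le (by simp only [pow_add, ← hi.2, ← hj.2, h]),
          hi.2, hj.2⟩
    obtain ⟨t, ht⟩ := exists_eq_twistedSubgroup M
    refine ⟨⟨⟨(i, j), by simpa using hij⟩, ⟨_, hi⟩, t⟩, Subtype.ext ?_⟩
    simp only
    rw [← hj, ← ht]

/-- Isomorphic groups have the same subgroups of a given index. -/
def AddEquiv.subgroupsOfIndexEquiv {A B : Type*} [AddGroup A] [AddGroup B] (e : A ≃+ B) (m : ℕ) :
    {M : AddSubgroup A // M.index = m} ≃ {M : AddSubgroup B // M.index = m} :=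
  e.mapAddSubgroup.toEquiv.subtypeEquiv fun M => by
    have : (M.map (e : A →+ B)).index = M.index := AddSubgroup.index_map_equiv M e
    simp [this]

theorem card_subgroups_index_prod_int (A : Type*) [AddCommGroup A] {p : ℕ} (hp : p.Prime)
    (hA : ∀ n, Finite {N : AddSubgroup A // N.index = p ^ n}) (n : ℕ) :
    Finite {M : AddSubgroup (A × ℤ) // M.index = p ^ n} ∧
    Nat.card {M : AddSubgroup (A × ℤ) // M.index = p ^ n} =
      ∑ ij ∈ Finset.HasAntidiagonal.antidiagonal n,
        Nat.card {N : AddSubgroup A // N.index = p ^ ij.1} * p ^ ij.1 := by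
  have hq (i : ℕ) (N : {N : AddSubgroup A // N.index = p ^ i}) : Finite (A ⧸ N.1) :=
    AddSubgroup.index_ne_zero_iff_finite.1 (by rw [N.2]; exact pow_ne_zero _ hp.ne_zero)
  have hA' (i : ℕ) := Fintype.ofFinite {N : AddSubgroup A // N.index = p ^ i}
  refine ⟨Finite.of_equiv _ (subgroupsProdIntEquiv A hp n), ?_⟩
  rw [← Nat.card_congr (subgroupsProdIntEquiv A hp n), Nat.card_sigma,
    ← Finset.sum_coe_sort (Finset.HasAntidiagonal.antidiagonal n)]
  refine Finset.sum_congr rfl fun ij _ => ?_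
  rw [Nat.card_sigma, Finset.sum_congr rfl fun N _ =>
    (AddSubgroup.index_eq_card N.1).symm.trans N.2]
  simp

theorem card_subgroups_index_int_pow_succ {p : ℕ} (hp : p.Prime) (k n : ℕ)
    (h : ∀ n, Finite {M : AddSubgroup (Fin k → ℤ) // M.index = p ^ n}) :
    Finite {M : AddSubgroup (Fin (k + 1) → ℤ) // M.index = p ^ n} ∧
    Nat.card {M : AddSubgroup (Fin (k + 1) → ℤ) // M.index = p ^ n} =
      ∑ ij ∈ Finset.HasAntidiagonal.antidiagonal n,
        Nat.card {N : AddSubgroup (Fin k → ℤ) // N.index = p ^ ij.1} * p ^ ij.1 := by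
  have e : (Fin (k + 1) → ℤ) ≃ₗ[ℤ] (Fin k → ℤ) × ℤ := LinearEquiv.ofFinrankEq _ _ (by simp)
  obtain ⟨h₁, h₂⟩ := card_subgroups_index_prod_int (Fin k → ℤ) hp h n
  exact ⟨Finite.of_equiv _ (e.symm.toAddEquiv.subgroupsOfIndexEquiv (p ^ n)),
    (Nat.card_congr (e.toAddEquiv.subgroupsOfIndexEquiv (p ^ n))).trans h₂⟩

theorem finite_subgroups_index_int_pow {p : ℕ} (hp : p.Prime) (k n : ℕ) :
    Finite {M : AddSubgroup (Fin k → ℤ) // M.index = p ^ n} := by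
  induction k generalizing n with
  | zero =>
    have : Finite (AddSubgroup (Fin 0 → ℤ)) := Finite.of_injective _ SetLike.coe_injective
    infer_instance
  | succ k ih => exact (card_subgroups_index_int_pow_succ hp k n ih).1

theorem hasSum_card_subgroups_index_int_pow {p : ℕ} (hp : p.Prime) (k : ℕ) {x : ℝ} (hx : 0 ≤ x)
    (hxp : ∀ j < k, (p : ℝ) ^ j * x < 1) :
    HasSum (fun n => (Nat.card {M : AddSubgroup (Fin k → ℤ) // M.index = p ^ n} : ℝ) * x ^ n)
      (∏ j ∈ Finset.range k, (1 - (p : ℝ) ^ j * x)⁻¹) := by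
  induction k generalizing x with
  | zero =>
    have h (n : ℕ) (hn : n ≠ 0) :
        (Nat.card {M : AddSubgroup (Fin 0 → ℤ) // M.index = p ^ n} : ℝ) * x ^ n = 0 := by
      have : IsEmpty {M : AddSubgroup (Fin 0 → ℤ) // M.index = p ^ n} := by
        refine ⟨fun M => ?_⟩
        have hM := M.2
        rw [Subsingleton.elim M.1 ⊤, AddSubgroup.index_top] at hM
        exact hn ((Nat.pow_eq_one.1 hM.symm).resolve_left hp.one_lt.ne')
      simp
    convert hasSum_single (f := fun n =>
      (Nat.card {M : AddSubgroup (Fin 0 → ℤ) // M.index = p ^ n} : ℝ) * x ^ n) 0 h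
    have : Unique {M : AddSubgroup (Fin 0 → ℤ) // M.index = p ^ 0} :=
      ⟨⟨⟨⊤, by simp⟩⟩, fun M => Subtype.ext (Subsingleton.elim _ _)⟩
    simp
  | succ k ih =>
    have hpx : ∀ j < k, (p : ℝ) ^ j * (p * x) < 1 := fun j hj => by
      rw [← mul_assoc, ← pow_succ]
      exact hxp (j + 1) (by omega)
    have hx1 : x < 1 := by simpa using hxp 0 k.succ_pos
    have h₁ := ih (x := p * x) (by positivity) hpx
    have h₂ := hasSum_geometric_of_lt_one hx hx1
    have h₁' : Summable fun n => ‖(Nat.card {M : AddSubgroup (Fin k → ℤ) // M.index = p ^ n} : ℝ)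
        * (p * x) ^ n‖ := h₁.summable.norm
    have h₂' : Summable fun n => ‖x ^ n‖ := h₂.summable.norm
    have h₃ := (summable_norm_sum_mul_antidiagonal_of_summable_norm h₁' h₂').of_norm.hasSum
    rw [← tsum_mul_tsum_eq_tsum_sum_antidiagonal_of_summable_norm h₁' h₂', h₁.tsum_eq,
      h₂.tsum_eq] at h₃
    rw [Finset.prod_range_succ', pow_zero, one_mul]
    simp only [pow_succ, mul_assoc]
    refine (congrArg (HasSum · _) (funext fun n => ?_)).mpr h₃
    rw [(card_subgroups_index_int_pow_succ hp k n (finite_subgroups_index_int_pow hp k)).2]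
    push_cast
    rw [Finset.sum_mul]
    refine Finset.sum_congr rfl fun ij hij => ?_
    rw [← Finset.HasAntidiagonal.mem_antidiagonal.1 hij]
    ring

section surjections

variable {A B G : Type*} [AddCommGroup A] [AddCommGroup B] [AddCommGroup G]

/-- A surjection onto `G` is a subgroup together with an identification of the quotient. -/
noncomputable def sigmaQuotientEquivEquivSurjections (A G : Type*) [AddCommGroup A]
    [AddCommGroup G] :
    (Σ M : {M : AddSubgroup A // Nonempty (A ⧸ M ≃+ G)}, (A ⧸ M.1 ≃+ G)) ≃
      {f : A →+ G // Function.Surjective f} := by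
  refine Equiv.ofBijective (fun x => ⟨(x.2 : A ⧸ x.1.1 →+ G).comp (QuotientAddGroup.mk' x.1.1),
    x.2.surjective.comp (QuotientAddGroup.mk'_surjective _)⟩) ⟨?_, ?_⟩
  · rintro ⟨⟨M, hM⟩, e⟩ ⟨⟨M', hM'⟩, e'⟩ h
    have h := congrArg Subtype.val h
    simp only at h
    have hker (M : AddSubgroup A) (e : A ⧸ M ≃+ G) :
        ((e : A ⧸ M →+ G).comp (QuotientAddGroup.mk' M)).ker = M := by
      ext a; simp
    obtain rfl : M = M' := by rw [← hker M e, h, hker]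
    congr
    ext a
    obtain ⟨a, rfl⟩ := QuotientAddGroup.mk_surjective a
    exact DFunLike.congr_fun h a
  · rintro ⟨f, hf⟩
    exact ⟨⟨⟨f.ker, ⟨QuotientAddGroup.quotientKerEquivOfSurjective f hf⟩⟩,
      QuotientAddGroup.quotientKerEquivOfSurjective f hf⟩, rfl⟩

theorem numSur_eq_card_mul_card_addAut :
    numSur A G = Nat.card {M : AddSubgroup A // Nonempty (A ⧸ M ≃+ G)} * Nat.card (AddAut G) := by
  rw [numSur, ← Nat.card_congr (sigmaQuotientEquivEquivSurjections A G), ← Nat.card_prod]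
  exact Nat.card_congr ((Equiv.sigmaCongrRight fun M =>
    ⟨fun e => M.2.some.symm.trans e, fun e => M.2.some.trans e, fun e => by ext; simp,
      fun e => by ext; simp⟩).trans (Equiv.sigmaEquivProd _ _))

theorem numSur_congr_left (e : A ≃+ B) : numSur A G = numSur B G :=
  Nat.card_congr
    { toFun f := ⟨f.1.comp (e.symm : B →+ A), f.2.comp e.symm.surjective⟩
      invFun f := ⟨f.1.comp (e : A →+ B), f.2.comp e.surjective⟩
      left_inv f := by ext; simp
      right_inv f := by ext; simp }

/-- Surjections from quotients of `A` correspond to surjections from `A` together with a subgroup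
of the kernel. -/
noncomputable def sigmaSurjectionsQuotientEquiv (A H : Type*) [AddCommGroup A] [AddCommGroup H]
    (P : AddSubgroup A → Prop) :
    (Σ M : {M : AddSubgroup A // P M}, {f : A ⧸ M.1 →+ H // Function.Surjective f}) ≃
      Σ f : {f : A →+ H // Function.Surjective f}, {M : AddSubgroup A // M ≤ f.1.ker ∧ P M} where
  toFun x := ⟨⟨x.2.1.comp (QuotientAddGroup.mk' x.1.1),
      x.2.2.comp (QuotientAddGroup.mk'_surjective _)⟩, ⟨x.1.1, fun a ha => by
        simp [AddMonoidHom.mem_ker, (QuotientAddGroup.eq_zero_iff a).2 ha], x.1.2⟩⟩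
  invFun y := ⟨⟨y.2.1, y.2.2.2⟩, ⟨QuotientAddGroup.lift y.2.1 y.1.1 y.2.2.1, by
    intro h
    obtain ⟨a, rfl⟩ := y.1.2 h
    exact ⟨a, rfl⟩⟩⟩
  left_inv := by
    rintro ⟨⟨M, hM⟩, f, hf⟩
    simp only [Sigma.mk.injEq, heq_eq_eq, true_and]
    ext a
    rfl
  right_inv := by
    rintro ⟨⟨f, hf⟩, M, hM, hP⟩
    rfl

theorem card_subgroups_le_index {H : Type*} [AddCommGroup H] {k : ℕ} {p : ℕ} (hp : p.Prime) {h : ℕ}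
    (hH : Nat.card H = p ^ h) (f : (Fin k → ℤ) →+ H) (hf : Function.Surjective f) (n : ℕ) :
    Nat.card {M : AddSubgroup (Fin k → ℤ) // M ≤ f.ker ∧ M.index = p ^ (n + h)} =
      Nat.card {M : AddSubgroup (Fin k → ℤ) // M.index = p ^ n} := by
  have hker : f.ker.index = p ^ h := by
    rw [AddSubgroup.index_ker, AddMonoidHom.range_eq_top.2 hf, ← hH]
    simp
  have h0 : p ^ h ≠ 0 := pow_ne_zero _ hp.ne_zero
  obtain ⟨e⟩ := Int.addSubgroup_index_ne_zero_iff.1 (hker.trans_ne h0)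
  rw [← Nat.card_congr (e.subgroupsOfIndexEquiv (p ^ n))]
  refine Nat.card_congr (Equiv.trans (Equiv.subtypeSubtypeEquivSubtypeInter _ _).symm
    ((AddSubgroup.MapSubtype.orderIso f.ker).toEquiv.symm.subtypeEquiv fun M => ?_))
  have := AddSubgroup.relIndex_mul_index M.2
  rw [hker] at this
  change _ ↔ M.1.relIndex f.ker = _
  rw [← this, pow_add, mul_left_inj' h0]

theorem card_subgroups_le_index_of_lt {H : Type*} [AddCommGroup H] {p : ℕ} (hp : p.Prime) {h : ℕ}
    (hH : Nat.card H = p ^ h) (f : A →+ H) (hf : Function.Surjective f) {n : ℕ} (hn : n < h) :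
    Nat.card {M : AddSubgroup A // M ≤ f.ker ∧ M.index = p ^ n} = 0 := by
  have : IsEmpty {M : AddSubgroup A // M ≤ f.ker ∧ M.index = p ^ n} := by
    refine ⟨fun M => ?_⟩
    have hker : f.ker.index = p ^ h := by
      rw [AddSubgroup.index_ker, AddMonoidHom.range_eq_top.2 hf, ← hH]
      simp
    have := AddSubgroup.index_dvd_of_le M.2.1
    rw [M.2.2, hker, Nat.pow_dvd_pow_iff_le_right hp.one_lt] at this
    omega
  simp

end surjections


/-- Families with the same multiset of values differ by a reindexing. -/
theorem exists_equiv_comp_eq_of_map_univ_eq {ι κ α : Type*} [Fintype ι] [Fintype κ]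
    {f : ι → α} {g : κ → α} (h : Finset.univ.val.map f = Finset.univ.val.map g) :
    ∃ e : ι ≃ κ, g ∘ e = f := by
  classical
  have hc (a : α) : Fintype.card {i // f i = a} = Fintype.card {j // g j = a} := by
    have := congrArg (Multiset.count a) h
    rw [Multiset.count_map, Multiset.count_map] at this
    rw [Fintype.card_subtype, Fintype.card_subtype, Finset.card, Finset.card]
    simpa only [Finset.filter_val, eq_comm] using this
  refine ⟨(Equiv.sigmaFiberEquiv f).symm.trans ((Equiv.sigmaCongrRight fun a =>
    Fintype.equivOfCardEq (hc a)).trans (Equiv.sigmaFiberEquiv g)), funext fun i => ?_⟩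
  exact (Fintype.equivOfCardEq (hc (f i)) ⟨i, rfl⟩).2

theorem nonempty_addEquiv_pi_zmod_of_map_univ_eq {ι κ : Type*} [Fintype ι] [Fintype κ]
    {f : ι → ℕ} {g : κ → ℕ} (h : Finset.univ.val.map f = Finset.univ.val.map g) :
    Nonempty ((∀ i, ZMod (f i)) ≃+ ∀ j, ZMod (g j)) := by
  obtain ⟨e, rfl⟩ := exists_equiv_comp_eq_of_map_univ_eq h
  exact ⟨(LinearEquiv.piCongrLeft ℤ (fun j => ZMod (g j)) e).toAddEquiv⟩

/-- The finite abelian `p`-group `⨁ ℤ / p ^ i` with `i` ranging over the multiset `s`. -/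
abbrev AbelianPGroup (p : ℕ) (s : Multiset ℕ) : Type :=
  ∀ i : Fin s.toList.length, ZMod (p ^ s.toList.get i)

theorem Multiset.map_get_toList_univ {α : Type*} (s : Multiset α) :
    (Finset.univ : Finset (Fin s.toList.length)).val.map s.toList.get = s := by
  rw [Fin.univ_val_map, List.ofFn_get, Multiset.coe_toList]

theorem Multiset.prod_get_toList {M : Type*} [CommMonoid M] {α : Type*} (s : Multiset α)
    (f : α → M) : ∏ i, f (s.toList.get i) = (s.map f).prod := by
  conv_rhs => rw [← s.map_get_toList_univ, Multiset.map_map]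
  rfl

theorem Multiset.sum_get_toList {α : Type*} (s : Multiset α)
    (f : α → ℕ) : ∑ i, f (s.toList.get i) = (s.map f).sum := by
  conv_rhs => rw [← s.map_get_toList_univ, Multiset.map_map]
  rfl

theorem card_abelianPGroup (p : ℕ) (s : Multiset ℕ) :
    Nat.card (AbelianPGroup p s) = p ^ s.sum := by
  rw [Nat.card_pi]
  simp only [Nat.card_zmod]
  rw [Finset.prod_pow_eq_pow_sum, Multiset.sum_get_toList s fun x => x, Multiset.map_id']

theorem card_torsion_abelianPGroup {p : ℕ} (hp : p.Prime) (s : Multiset ℕ) (j : ℕ) :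
    Nat.card {x : AbelianPGroup p s // p ^ j • x = 0} = p ^ (s.map (min · j)).sum := by
  have := Fact.mk hp
  have h (i : ℕ) : Nat.card {x : ZMod (p ^ i) // p ^ j • x = 0} = p ^ min i j := by
    have := IsAddCyclic.card_nsmulAddMonoidHom_ker (ZMod (p ^ i)) (p ^ j)
    rw [Nat.card_zmod] at this
    have hgcd : (p ^ i).gcd (p ^ j) = p ^ min i j := by
      rcases le_total i j with hij | hij
      · rw [min_eq_left hij, Nat.gcd_eq_left (pow_dvd_pow p hij)]
      · rw [min_eq_right hij, Nat.gcd_eq_right (pow_dvd_pow p hij)]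
    rw [← hgcd, ← this]
    rfl
  have e : {x : AbelianPGroup p s // p ^ j • x = 0} ≃
      ∀ i : Fin s.toList.length, {x : ZMod (p ^ s.toList.get i) // p ^ j • x = 0} :=
    (Equiv.subtypeEquivRight fun x => by simp [funext_iff]).trans Equiv.subtypePiEquivPi
  rw [Nat.card_congr e, Nat.card_pi, Finset.prod_congr rfl fun i _ => h _,
    Finset.prod_pow_eq_pow_sum, Multiset.sum_get_toList s (min · j)]

theorem Multiset.eq_of_sum_map_min_eq {s t : Multiset ℕ} (hs : 0 ∉ s) (ht : 0 ∉ t)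
    (h : ∀ j, (s.map (min · j)).sum = (t.map (min · j)).sum) : s = t := by
  have key (s : Multiset ℕ) (j : ℕ) : (s.map (min · j)).sum + (s.map (min · (j + 2))).sum +
      s.count (j + 1) = 2 * (s.map (min · (j + 1))).sum := by
    induction s using Multiset.induction_on with
    | empty => simp
    | cons a s ih =>
      simp only [Multiset.map_cons, Multiset.sum_cons, Multiset.count_cons]
      split_ifs <;> omega
  ext a
  rcases a with _ | a
  · rw [Multiset.count_eq_zero_of_notMem hs, Multiset.count_eq_zero_of_notMem ht]
  · have h₁ := key s a
    have h₂ := key t a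
    rw [h, h, h] at h₁
    omega

theorem eq_of_addEquiv_abelianPGroup {p : ℕ} (hp : p.Prime) {s t : Multiset ℕ} (hs : 0 ∉ s)
    (ht : 0 ∉ t) (e : AbelianPGroup p s ≃+ AbelianPGroup p t) : s = t := by
  refine Multiset.eq_of_sum_map_min_eq hs ht fun j => Nat.pow_right_injective hp.two_le ?_
  simp only
  rw [← card_torsion_abelianPGroup hp, ← card_torsion_abelianPGroup hp]
  refine Nat.card_congr (e.toEquiv.subtypeEquiv fun x => ?_)
  change _ ↔ p ^ j • e x = 0
  rw [← map_nsmul, map_eq_zero_iff e e.injective]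

theorem exists_addEquiv_abelianPGroup {p : ℕ} (hp : p.Prime) (G : Type*) [AddCommGroup G] {n : ℕ}
    (hG : Nat.card G = p ^ n) :
    ∃ lam : n.Partition, Nonempty (G ≃+ AbelianPGroup p lam.parts) := by
  have : Finite G := Nat.finite_of_card_ne_zero (hG.trans_ne (pow_ne_zero _ hp.ne_zero))
  obtain ⟨ι, _, m, hm, ⟨e⟩⟩ := AddCommGroup.equiv_directSum_zmod_of_finite' G
  classical
  replace e := e.trans (DirectSum.addEquivProd _)
  have hcard : ∏ i, m i = p ^ n := by
    rw [← hG, Nat.card_congr e.toEquiv, Nat.card_pi]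
    simp
  have hdvd (i : ι) : ∃ a, m i = p ^ a := by
    obtain ⟨a, -, ha⟩ := (Nat.dvd_prime_pow hp).1
      (hcard ▸ Finset.dvd_prod_of_mem m (Finset.mem_univ i))
    exact ⟨a, ha⟩
  choose a ha using hdvd
  refine ⟨⟨Finset.univ.val.map a, ?_, ?_⟩, ?_⟩
  · intro i hi
    obtain ⟨j, -, rfl⟩ := Multiset.mem_map.1 hi
    have := hm j
    rw [ha] at this
    exact Nat.pos_of_ne_zero fun h => by simp [h] at this
  · refine Nat.pow_right_injective hp.two_le ?_
    simp only
    rw [← hcard, Finset.prod_congr rfl fun i _ => ha i, Finset.prod_pow_eq_pow_sum]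
    rfl
  · obtain ⟨e'⟩ := nonempty_addEquiv_pi_zmod_of_map_univ_eq (f := m) (g := fun i =>
      p ^ (Finset.univ.val.map a).toList.get i) (by
        change _ = Multiset.map ((p ^ ·) ∘ (Finset.univ.val.map a).toList.get) _
        rw [← Multiset.map_map (p ^ ·), Multiset.map_get_toList_univ, Multiset.map_map]
        exact Multiset.map_congr rfl fun i _ => ha i)
    exact ⟨e.trans e'⟩

theorem sum_partition_card_mul_numSur {p : ℕ} (hp : p.Prime) (A H : Type*) [AddCommGroup A]
    [AddCommGroup H] [Finite H] (n : ℕ) (hA : Finite {M : AddSubgroup A // M.index = p ^ n}) :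
    ∑ lam : n.Partition,
        Nat.card {M : AddSubgroup A // Nonempty (A ⧸ M ≃+ AbelianPGroup p lam.parts)} *
          numSur (AbelianPGroup p lam.parts) H =
      Nat.card (Σ M : {M : AddSubgroup A // M.index = p ^ n},
        {f : A ⧸ M.1 →+ H // Function.Surjective f}) := by
  classical
  have := Fintype.ofFinite {M : AddSubgroup A // M.index = p ^ n}
  have hfin (M : {M : AddSubgroup A // M.index = p ^ n}) : Finite (A ⧸ M.1) :=
    AddSubgroup.index_ne_zero_iff_finite.1 (by rw [M.2]; exact pow_ne_zero _ hp.ne_zero)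
  have hfin' (M : {M : AddSubgroup A // M.index = p ^ n}) : Finite (A ⧸ M.1 →+ H) :=
    Finite.of_injective _ DFunLike.coe_injective
  have hτ (M : {M : AddSubgroup A // M.index = p ^ n}) :=
    exists_addEquiv_abelianPGroup hp (A ⧸ M.1) ((AddSubgroup.index_eq_card M.1).symm.trans M.2)
  choose τ e using hτ
  rw [Nat.card_sigma, ← Finset.sum_fiberwise _ τ]
  refine Finset.sum_congr rfl fun lam _ => ?_
  rw [Finset.sum_congr rfl (g := fun _ => numSur (AbelianPGroup p lam.parts) H) fun M hM => by
    obtain rfl := (Finset.mem_filter.1 hM).2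
    exact numSur_congr_left (e M).some]
  rw [Finset.sum_const, smul_eq_mul, ← Fintype.card_subtype, ← Nat.card_eq_fintype_card]
  congr 1
  have h0 (n : ℕ) (lam : n.Partition) : 0 ∉ lam.parts := fun h => (lam.parts_pos h).ne rfl
  exact (Nat.card_congr
    { toFun M := ⟨M.1.1, by
        obtain ⟨M, rfl⟩ := M
        exact e M⟩
      invFun M := ⟨⟨M.1, by
        rw [AddSubgroup.index_eq_card, Nat.card_congr M.2.some.toEquiv, card_abelianPGroup,
          lam.parts_sum]⟩, Nat.Partition.ext (eq_of_addEquiv_abelianPGroup hp (h0 _ _) (h0 _ _)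
            ((e _).some.symm.trans M.2.some))⟩
      left_inv M := rfl
      right_inv M := rfl }).symm

theorem sum_partition_numSur_mul_numSur {p : ℕ} (hp : p.Prime) (k : ℕ) (H : Type*)
    [AddCommGroup H] [Finite H] (n : ℕ) :
    ∑ lam : n.Partition, (numSur (AbelianPGroup p lam.parts) H : ℝ) *
        numSur (Fin k → ℤ) (AbelianPGroup p lam.parts) /
          Nat.card (AddAut (AbelianPGroup p lam.parts)) =
      Nat.card (Σ f : {f : (Fin k → ℤ) →+ H // Function.Surjective f},
        {M : AddSubgroup (Fin k → ℤ) // M ≤ f.1.ker ∧ M.index = p ^ n}) := by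
  have := Fact.mk hp
  rw [← Nat.card_congr (sigmaSurjectionsQuotientEquiv (Fin k → ℤ) H (·.index = p ^ n)),
    ← sum_partition_card_mul_numSur hp _ H n (finite_subgroups_index_int_pow hp k n)]
  push_cast
  refine Finset.sum_congr rfl fun lam _ => ?_
  have : Finite (AddAut (AbelianPGroup p lam.parts)) :=
    Finite.of_injective _ DFunLike.coe_injective
  have h0 : (Nat.card (AddAut (AbelianPGroup p lam.parts)) : ℝ) ≠ 0 :=
    Nat.cast_ne_zero.2 Nat.card_pos.ne'
  rw [numSur_eq_card_mul_card_addAut (A := Fin k → ℤ), Nat.cast_mul, div_eq_iff h0]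
  ring

/-- Homomorphisms from `ℤ ^ k` are `k`-tuples. -/
noncomputable def intPowHomEquiv (k : ℕ) (G : Type*) [AddCommGroup G] :
    ((Fin k → ℤ) →+ G) ≃ (Fin k → G) :=
  (addMonoidHomLequivInt ℤ).toEquiv.trans ((Pi.basisFun ℤ (Fin k)).constr ℤ).toEquiv.symm

theorem card_int_pow_hom (k : ℕ) (G : Type*) [AddCommGroup G] :
    Nat.card ((Fin k → ℤ) →+ G) = Nat.card G ^ k := by
  rw [Nat.card_congr (intPowHomEquiv k G), Nat.card_pi]
  simp

theorem finite_int_pow_hom (k : ℕ) (G : Type*) [AddCommGroup G] [Finite G] :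
    Finite ((Fin k → ℤ) →+ G) :=
  Finite.of_equiv _ (intPowHomEquiv k G).symm

theorem numSur_int_pow_le (k : ℕ) (G : Type*) [AddCommGroup G] [Finite G] :
    numSur (Fin k → ℤ) G ≤ Nat.card G ^ k := by
  have := finite_int_pow_hom k G
  rw [← card_int_pow_hom]
  exact Nat.card_le_card_of_injective _ Subtype.val_injective

theorem card_pow_le_numSur_add (k : ℕ) (G : Type*) [AddCommGroup G] [Finite G]
    [Fintype {K : AddSubgroup G // K ≠ ⊤}] :
    Nat.card G ^ k ≤
      numSur (Fin k → ℤ) G + ∑ K : {K : AddSubgroup G // K ≠ ⊤}, Nat.card K.1 ^ k := by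
  classical
  have := finite_int_pow_hom k G
  have hK (K : {K : AddSubgroup G // K ≠ ⊤}) := finite_int_pow_hom k K.1
  rw [← card_int_pow_hom, ← Nat.card_congr (Equiv.sumCompl fun f : (Fin k → ℤ) →+ G =>
    Function.Surjective f), Nat.card_sum]
  refine Nat.add_le_add_left ?_ _
  rw [Finset.sum_congr rfl fun K _ => (card_int_pow_hom k K.1).symm,
    ← Nat.card_sigma]
  refine Nat.card_le_card_of_injective (fun f => ⟨⟨f.1.range, fun h =>
    f.2 (AddMonoidHom.range_eq_top.1 h)⟩, f.1.rangeRestrict⟩) fun f g h => ?_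
  have := congrArg (fun x : Σ K : {K : AddSubgroup G // K ≠ ⊤}, (Fin k → ℤ) →+ K.1 =>
    x.1.1.subtype.comp x.2) h
  exact Subtype.ext this

open Filter Topology in
theorem tendsto_numSur_int_pow_div (G : Type*) [AddCommGroup G] [Finite G] :
    Tendsto (fun k => (numSur (Fin k → ℤ) G : ℝ) / (Nat.card G : ℝ) ^ k) atTop (𝓝 1) := by
  have := Fintype.ofFinite {K : AddSubgroup G // K ≠ ⊤}
  have hG : (0 : ℝ) < Nat.card G := Nat.cast_pos.2 Nat.card_pos
  have hlim : Tendsto (fun k => 1 - ∑ K : {K : AddSubgroup G // K ≠ ⊤},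
      ((Nat.card K.1 : ℝ) / Nat.card G) ^ k) atTop (𝓝 1) := by
    have := tendsto_finsetSum (Finset.univ : Finset {K : AddSubgroup G // K ≠ ⊤}) fun K _ =>
      tendsto_pow_atTop_nhds_zero_of_lt_one (r := (Nat.card K.1 : ℝ) / Nat.card G) (by positivity)
        (by
          rw [div_lt_one hG, Nat.cast_lt]
          exact lt_of_le_of_ne (Nat.card_le_card_of_injective _ Subtype.val_injective) fun h =>
            K.2 (AddSubgroup.eq_top_of_card_eq _ h))
    simpa using this.const_sub 1
  refine tendsto_of_tendsto_of_tendsto_of_le_of_le hlim tendsto_const_nhds (fun k => ?_)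
    fun k => ?_
  · simp only [div_pow]
    rw [← Finset.sum_div, sub_le_iff_le_add, ← add_div, one_le_div (by positivity)]
    exact_mod_cast card_pow_le_numSur_add k G
  · simp only
    rw [div_le_one (by positivity)]
    exact_mod_cast numSur_int_pow_le k G

theorem hasSum_sum_partition_numSur {p : ℕ} (hp : p.Prime) (u k : ℕ) (H : Type*)
    [AddCommGroup H] [Finite H] {h : ℕ} (hH : Nat.card H = p ^ h) :
    HasSum (fun n : ℕ => ∑ lam : n.Partition, (numSur (AbelianPGroup p lam.parts) H : ℝ) /
        ((Nat.card (AbelianPGroup p lam.parts) : ℝ) ^ u *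
          Nat.card (AddAut (AbelianPGroup p lam.parts))) *
        (numSur (Fin k → ℤ) (AbelianPGroup p lam.parts) /
          (Nat.card (AbelianPGroup p lam.parts) : ℝ) ^ k))
      (numSur (Fin k → ℤ) H / (Nat.card H : ℝ) ^ k * ((Nat.card H : ℝ) ^ u)⁻¹ *
        (∏ j ∈ Finset.range k, (1 - (p : ℝ) ^ (-((j : ℤ) + 1 + u))))⁻¹) := by
  have hp0 : (p : ℝ) ≠ 0 := Nat.cast_ne_zero.2 hp.ne_zero
  have hp1 : (1 : ℝ) < p := Nat.one_lt_cast.2 hp.one_lt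
  set x : ℝ := ((p : ℝ) ^ (u + k))⁻¹ with hx
  have hpx (j : ℕ) : (p : ℝ) ^ j * x = (p : ℝ) ^ ((j : ℤ) - u - k) := by
    rw [hx, sub_sub, zpow_sub₀ hp0]
    rw [zpow_natCast, ← Nat.cast_add, zpow_natCast, div_eq_mul_inv]
  have hsum := hasSum_card_subgroups_index_int_pow hp k (x := x) (by positivity) fun j hj => by
    rw [hpx]
    exact zpow_lt_one_of_neg₀ hp1 (by omega)
  have hprod : ∏ j ∈ Finset.range k, (1 - (p : ℝ) ^ j * x)⁻¹ =
      (∏ j ∈ Finset.range k, (1 - (p : ℝ) ^ (-((j : ℤ) + 1 + u))))⁻¹ := by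
    rw [← Finset.prod_inv_distrib, ← Finset.prod_range_reflect]
    refine Finset.prod_congr rfl fun j hj => ?_
    have := Finset.mem_range.1 hj
    rw [hpx]
    congr 4
    omega
  rw [hprod] at hsum
  have hterm (n : ℕ) : ∑ lam : n.Partition, (numSur (AbelianPGroup p lam.parts) H : ℝ) /
        ((Nat.card (AbelianPGroup p lam.parts) : ℝ) ^ u *
          Nat.card (AddAut (AbelianPGroup p lam.parts))) *
        (numSur (Fin k → ℤ) (AbelianPGroup p lam.parts) /
          (Nat.card (AbelianPGroup p lam.parts) : ℝ) ^ k) =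
      Nat.card (Σ f : {f : (Fin k → ℤ) →+ H // Function.Surjective f},
        {M : AddSubgroup (Fin k → ℤ) // M ≤ f.1.ker ∧ M.index = p ^ n}) * x ^ n := by
    rw [← sum_partition_numSur_mul_numSur hp, Finset.sum_mul]
    refine Finset.sum_congr rfl fun lam _ => ?_
    have hx' : x ^ n = (((p : ℝ) ^ n) ^ u)⁻¹ * (((p : ℝ) ^ n) ^ k)⁻¹ := by
      rw [hx, ← mul_inv, ← pow_add, inv_pow, ← pow_mul, ← pow_mul, mul_comm n]
    rw [card_abelianPGroup, lam.parts_sum, hx', Nat.cast_pow]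
    simp only [div_eq_mul_inv, mul_inv]
    ring
  simp only [hterm]
  have := finite_int_pow_hom k H
  have := Fintype.ofFinite {f : (Fin k → ℤ) →+ H // Function.Surjective f}
  have hfin (n : ℕ) (f : {f : (Fin k → ℤ) →+ H // Function.Surjective f}) :
      Finite {M : AddSubgroup (Fin k → ℤ) // M ≤ f.1.ker ∧ M.index = p ^ n} := by
    have := finite_subgroups_index_int_pow hp k n
    exact Finite.of_injective (fun M => (⟨M.1, M.2.2⟩ : {M : AddSubgroup _ // M.index = p ^ n}))
      fun M N hMN => Subtype.ext (Subtype.mk.inj hMN)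
  simp only [Nat.card_sigma]
  rw [← (add_left_injective h).hasSum_iff]
  · refine (congrArg₂ HasSum (funext fun n => ?_) ?_).mpr
      (hsum.mul_left (numSur (Fin k → ℤ) H * x ^ h))
    · simp only [Function.comp_apply]
      rw [Finset.sum_congr rfl fun f _ => card_subgroups_le_index hp hH f.1 f.2 n,
        Finset.sum_const, Finset.card_univ, ← Nat.card_eq_fintype_card, numSur,
        smul_eq_mul, Nat.cast_mul]
      ring
    · have : x ^ h = ((Nat.card H : ℝ) ^ u)⁻¹ * ((Nat.card H : ℝ) ^ k)⁻¹ := by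
        rw [hH, hx, ← mul_inv, ← pow_add, inv_pow, Nat.cast_pow, ← pow_mul, ← pow_mul, mul_comm h]
      rw [this]
      ring
  · intro n hn
    have hlt : n < h := by
      by_contra! hle
      exact hn ⟨n - h, by simp [hle]⟩
    rw [Finset.sum_eq_zero fun f _ => card_subgroups_le_index_of_lt hp hH f.1 f.2 hlt]
    simp

open Filter Topology in
theorem tprod_ne_zero_and_tendsto_prod_one_sub_zpow {p : ℕ} (hp : p.Prime) (u : ℕ) :
    ∏' k : ℕ, (1 - (p : ℝ) ^ (-((k : ℤ) + 1 + u))) ≠ 0 ∧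
    Tendsto (fun k => ∏ j ∈ Finset.range k, (1 - (p : ℝ) ^ (-((j : ℤ) + 1 + u)))) atTop
      (𝓝 (∏' k : ℕ, (1 - (p : ℝ) ^ (-((k : ℤ) + 1 + u))))) := by
  have hp1 : (1 : ℝ) < p := Nat.one_lt_cast.2 hp.one_lt
  have hsum : Summable fun k : ℕ => ‖-(p : ℝ) ^ (-((k : ℤ) + 1 + u))‖ := by
    have := (summable_geometric_of_lt_one (r := (p : ℝ)⁻¹) (by positivity)
      (inv_lt_one_of_one_lt₀ hp1)).mul_left ((p : ℝ) ^ (1 + u))⁻¹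
    refine this.congr fun k => ?_
    rw [norm_neg, Real.norm_of_nonneg (by positivity), inv_pow, ← mul_inv, ← pow_add, zpow_neg,
      ← zpow_natCast]
    congr 2
    push_cast
    ring
  simp only [sub_eq_add_neg]
  refine ⟨tprod_one_add_ne_zero_of_summable (fun k => ?_) hsum,
    (multipliable_one_add_of_summable hsum).hasProd.tendsto_prod_nat⟩
  rw [← sub_eq_add_neg]
  exact (sub_pos.2 (zpow_lt_one_of_neg₀ hp1 (by omega))).ne'

/-- The `H`-moment of the Cohen–Lenstra distribution with parameter `u` is
`|H|^{-u}`: summing over all isomorphism classes of finite abelian `p`-groups, indexed by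
partitions `λ` (of all natural numbers `n`) with `G_λ = ⊕ᵢ ℤ/p^{λᵢ}ℤ`,
`∑_G #Sur(G, H)/(|G|^u |Aut G|) · ∏_{k≥1} (1 - p^{-k-u}) = |H|^{-u}`. -/
theorem cohenLenstra_moment
    (p : ℕ) (hp : p.Prime) (u : ℕ)
    (H : Type*) [AddCommGroup H] [Fintype H] (hH : ∃ k : ℕ, Nat.card H = p ^ k) :
    (∑' n : ℕ, ∑ lam : n.Partition,
        (numSur (∀ i : Fin lam.parts.toList.length, ZMod (p ^ lam.parts.toList.get i)) H : ℝ) /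
          ((Nat.card (∀ i : Fin lam.parts.toList.length,
              ZMod (p ^ lam.parts.toList.get i)) : ℝ) ^ u *
            (Nat.card (AddAut (∀ i : Fin lam.parts.toList.length,
              ZMod (p ^ lam.parts.toList.get i))) : ℝ)))
      * ∏' k : ℕ, (1 - (p : ℝ) ^ (-((k : ℤ) + 1 + u)))
    = ((Nat.card H : ℝ) ^ u)⁻¹ := by
  obtain ⟨h, hH⟩ := hH
  have := Fact.mk hp
  obtain ⟨hP0, hP⟩ := tprod_ne_zero_and_tendsto_prod_one_sub_zpow hp u
  rw [← eq_div_iff hP0, div_eq_mul_inv]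
  have hF (k : ℕ) := hasSum_sum_partition_numSur hp u k H hH
  have hS := ((tendsto_numSur_int_pow_div H).mul_const ((Nat.card H : ℝ) ^ u)⁻¹).mul (hP.inv₀ hP0)
  rw [one_mul] at hS
  have hT (n : ℕ) := tendsto_finsetSum (Finset.univ : Finset n.Partition) fun lam _ =>
    (tendsto_numSur_int_pow_div (AbelianPGroup p lam.parts)).const_mul
      ((numSur (AbelianPGroup p lam.parts) H : ℝ) /
        ((Nat.card (AbelianPGroup p lam.parts) : ℝ) ^ u *
          Nat.card (AddAut (AbelianPGroup p lam.parts))))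
  simp only [mul_one] at hT
  have hT0 (n : ℕ) : 0 ≤ ∑ lam : n.Partition, (numSur (AbelianPGroup p lam.parts) H : ℝ) /
      ((Nat.card (AbelianPGroup p lam.parts) : ℝ) ^ u *
        Nat.card (AddAut (AbelianPGroup p lam.parts))) :=
    Finset.sum_nonneg fun lam _ => by positivity
  have hsummable := summable_of_sum_le hT0 fun s =>
    le_of_tendsto_of_tendsto' (tendsto_finsetSum s fun n _ => hT n) hS fun k =>
      sum_le_hasSum s (fun n _ => Finset.sum_nonneg fun lam _ => by positivity) (hF k)
  have hlim := tendsto_tsum_of_dominated_convergence hsummable hT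
    (Filter.Eventually.of_forall fun k n => by
      rw [Real.norm_of_nonneg (Finset.sum_nonneg fun lam _ => by positivity)]
      refine Finset.sum_le_sum fun lam _ => mul_le_of_le_one_right (by positivity) ?_
      refine div_le_one_of_le₀ ?_ (by positivity)
      exact_mod_cast numSur_int_pow_le k (AbelianPGroup p lam.parts))
  simp only [fun k => (hF k).tsum_eq] at hlim
  exact tendsto_nhds_unique hlim hS
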